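/- Assume there exists x₁ ∈ [0, A] with x₁² < P and ℰ(x₁) > E_req. Then F* ∈ Ω satisfies I(F*) = C if and only if there exist λ₁ ≥ 0 and λ₂ ≥ 0 such that λ₁·(∫₀^A x² dF*(x) − P) = 0, λ₂·(E_req − ∫₀^A ℰ(x) dF*(x)) = 0, and for every Borel probability measure F on [0, A]: ∫₀^A i(x; F*) dF(x) ≤ C + λ₁·(∫₀^A x² dF(x) − P) + λ₂·(E_req − ∫₀^A ℰ(x) dF(x)). -/

import Mathlib

open MeasureTheory Real Set Filter

/-- Phase-removed Rayleigh-fading channel density `p(y|x)`. -/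
noncomputable def pcond (x y : ℝ) : ℝ := (1 / (1 + x ^ 2)) * Real.exp (-y / (1 + x ^ 2))

/-- Modified Bessel function of the first kind, order zero. -/
noncomputable def besselI0 (t : ℝ) : ℝ := ∑' n : ℕ, (t ^ 2 / 4) ^ n / ((Nat.factorial n : ℝ)) ^ 2

/-- Harvested-energy function `ℰ(x) = I₀(√2 B h₂ x)`. -/
noncomputable def EH (B h2 x : ℝ) : ℝ := besselI0 (Real.sqrt 2 * B * h2 * x)

/-- Output density `p(y; F)`. -/
noncomputable def pout (F : Measure ℝ) (y : ℝ) : ℝ := ∫ x, pcond x y ∂F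

/-- Mutual-information density `i(x; F)`. -/
noncomputable def idens (F : Measure ℝ) (x : ℝ) : ℝ :=
  ∫ y in Set.Ioi (0 : ℝ), pcond x y * Real.log (pcond x y / pout F y)

/-- Mutual information `I(F)`. -/
noncomputable def MI (F : Measure ℝ) : ℝ := ∫ x, idens F x ∂F

/-- Borel probability measure concentrated on `[0, A]`. -/
def IsDistOn (A : ℝ) (F : Measure ℝ) : Prop :=
  IsProbabilityMeasure F ∧ F (Set.Icc 0 A)ᶜ = 0

/-- The feasible set `Ω`: probability measures on `[0,A]` meeting the AP and EH constraints. -/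
def Feas (A P B h2 Ereq : ℝ) (F : Measure ℝ) : Prop :=
  IsDistOn A F ∧ (∫ x, x ^ 2 ∂F) ≤ P ∧ Ereq ≤ ∫ x, EH B h2 x ∂F

/-- Information-energy capacity `C = sup_{F ∈ Ω} I(F)`. -/
noncomputable def Cap (A P B h2 Ereq : ℝ) : ℝ :=
  sSup (MI '' {F | Feas A P B h2 Ereq F})

/-- Topological support of a measure: points all of whose open neighborhoods have
positive measure (the smallest closed set of full measure). -/
def msupp {X : Type*} [TopologicalSpace X] [MeasurableSpace X] (μ : Measure X) : Set X :=
  {x | ∀ U : Set X, IsOpen U → x ∈ U → 0 < μ U}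

theorem integrableOn_pow_mul_exp_neg {c : ℝ} (hc : 0 < c) (k : ℕ) :
    IntegrableOn (fun y : ℝ => y ^ k * exp (-(c * y))) (Ioi 0) := by
  have h := integrableOn_rpow_mul_exp_neg_mul_rpow (p := 1) (s := (k : ℝ)) (b := c)
    (by linarith [(Nat.cast_nonneg k : (0 : ℝ) ≤ k)]) one_pos hc
  simpa [rpow_natCast] using h

theorem integral_pow_mul_exp_neg {c : ℝ} (hc : 0 < c) (k : ℕ) :
    ∫ y in Ioi (0 : ℝ), y ^ k * exp (-(c * y)) = (k.factorial : ℝ) / c ^ (k + 1) := by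
  have h := integral_rpow_mul_exp_neg_mul_Ioi (a := (k : ℝ) + 1) (by positivity) hc
  rw [Gamma_nat_eq_factorial] at h
  have e : (1 / c) ^ ((k : ℝ) + 1) = (1 / c) ^ (k + 1) := by
    rw [← rpow_natCast]; norm_cast
  rw [e] at h
  simp only [add_sub_cancel_right, rpow_natCast] at h
  rw [h, one_div, inv_pow]
  ring

theorem pcond_pos (x y : ℝ) : 0 < pcond x y := by
  unfold pcond; positivity

theorem continuous_pcond : Continuous (Function.uncurry pcond) := by
  unfold Function.uncurry pcond
  have h : ∀ a : ℝ × ℝ, 1 + a.1 ^ 2 ≠ 0 := fun a => by positivity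
  fun_prop (disch := exact h)

theorem pcond_le {A x y : ℝ} (hx : x ∈ Icc 0 A) (hy : 0 ≤ y) :
    pcond x y ≤ exp (-(1 / (1 + A ^ 2) * y)) := by
  have h1 : x ^ 2 ≤ A ^ 2 := pow_le_pow_left₀ hx.1 hx.2 2
  unfold pcond
  have h2 : 1 / (1 + x ^ 2) ≤ 1 := by
    rw [div_le_one (by positivity)]; nlinarith [sq_nonneg x]
  have h3 : exp (-y / (1 + x ^ 2)) ≤ exp (-(1 / (1 + A ^ 2) * y)) := by
    apply exp_le_exp.2
    rw [neg_div, neg_le_neg_iff, one_div_mul_eq_div]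
    gcongr
  calc _ ≤ 1 * exp (-y / (1 + x ^ 2)) := by gcongr
    _ ≤ _ := by rw [one_mul]; exact h3

theorem le_pcond {A x y : ℝ} (hx : x ∈ Icc 0 A) (hy : 0 ≤ y) :
    1 / (1 + A ^ 2) * exp (-y) ≤ pcond x y := by
  have h1 : x ^ 2 ≤ A ^ 2 := pow_le_pow_left₀ hx.1 hx.2 2
  unfold pcond
  have h3 : -y ≤ -y / (1 + x ^ 2) := by
    rw [neg_div, neg_le_neg_iff]
    exact div_le_self hy (by nlinarith [sq_nonneg x])
  gcongr

/-- Measurable functions on `(0, ∞)` of at most linear growth. -/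
def LinGrowth (g : ℝ → ℝ) : Prop :=
  Measurable g ∧ ∃ c, ∀ y, 0 < y → |g y| ≤ c * (1 + y)

/-- The channel operator `x ↦ ∫ p(y|x) g(y) dy`. -/
noncomputable def chan (g : ℝ → ℝ) (x : ℝ) : ℝ := ∫ y in Ioi (0 : ℝ), pcond x y * g y

/-- An integrable envelope for `p(y|x) g(y)`, `x ∈ [0, A]`, with `g` of linear growth. -/
noncomputable def envelope (A c y : ℝ) : ℝ := exp (-(1 / (1 + A ^ 2) * y)) * (c * (1 + y))

theorem integrable_envelope (A c : ℝ) :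
    Integrable (envelope A c) (volume.restrict (Ioi 0)) := by
  have hc : 0 < 1 / (1 + A ^ 2) := by positivity
  have h := ((integrableOn_pow_mul_exp_neg hc 0).add (integrableOn_pow_mul_exp_neg hc 1)).const_mul c
  refine h.congr (Eventually.of_forall fun y => ?_)
  simp [envelope]; ring

theorem abs_pcond_mul_le {A c x y : ℝ} {g : ℝ → ℝ} (hg : ∀ y, 0 < y → |g y| ≤ c * (1 + y))
    (hx : x ∈ Icc 0 A) (hy : 0 < y) : |pcond x y * g y| ≤ envelope A c y := by
  rw [abs_mul, abs_of_pos (pcond_pos x y)]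
  exact mul_le_mul (pcond_le hx hy.le) (hg y hy) (abs_nonneg _) (exp_pos _).le

theorem measurable_pcond_right (x : ℝ) : Measurable (pcond x) :=
  (continuous_pcond.comp (Continuous.prodMk_right x)).measurable

theorem continuous_pcond_left (y : ℝ) : Continuous (fun x => pcond x y) :=
  continuous_pcond.comp (Continuous.prodMk_left y)

theorem integrable_pcond_mul {A x : ℝ} {g : ℝ → ℝ} (hg : LinGrowth g) (hx : x ∈ Icc 0 A) :
    Integrable (fun y => pcond x y * g y) (volume.restrict (Ioi 0)) := by
  obtain ⟨hm, c, hc⟩ := hg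
  refine (integrable_envelope A c).mono' ((measurable_pcond_right x).mul hm).aestronglyMeasurable ?_
  filter_upwards [ae_restrict_mem measurableSet_Ioi] with y hy
  exact abs_pcond_mul_le hc hx hy

theorem continuousOn_chan {A : ℝ} {g : ℝ → ℝ} (hg : LinGrowth g) :
    ContinuousOn (chan g) (Icc 0 A) := by
  obtain ⟨hm, c, hc⟩ := hg
  unfold chan
  refine continuousOn_of_dominated (bound := envelope A c)
    (fun x _ => ((measurable_pcond_right x).mul hm).aestronglyMeasurable) (fun x hx => ?_)
    (integrable_envelope A c) (Eventually.of_forall fun y => ?_)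
  · filter_upwards [ae_restrict_mem measurableSet_Ioi] with y hy
    exact abs_pcond_mul_le hc hx hy
  · exact ((continuous_pcond_left y).mul continuous_const).continuousOn

theorem chan_pow_mul_exp (x : ℝ) {b : ℝ} (hb : 0 ≤ b) (k : ℕ) :
    chan (fun y => y ^ k * exp (-(b * y))) x =
      1 / (1 + x ^ 2) * ((k.factorial : ℝ) / (1 / (1 + x ^ 2) + b) ^ (k + 1)) := by
  have hc : 0 < 1 / (1 + x ^ 2) + b := by positivity
  rw [← integral_pow_mul_exp_neg hc k, ← integral_const_mul]
  unfold chan pcond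
  congr 1
  ext y
  rw [show -((1 / (1 + x ^ 2) + b) * y) = -y / (1 + x ^ 2) + -(b * y) by ring, exp_add]
  ring

theorem chan_one (x : ℝ) : chan (fun _ => 1) x = 1 := by
  have h := chan_pow_mul_exp x le_rfl 0
  have h2 : (1 + x ^ 2) ≠ 0 := by positivity
  simpa [h2] using h

namespace IsDistOn

variable {A : ℝ} {F G : Measure ℝ}

theorem ae_mem (hF : IsDistOn A F) : ∀ᵐ x ∂F, x ∈ Icc 0 A := hF.2

theorem integrable_of_continuousOn (hF : IsDistOn A F) {f : ℝ → ℝ}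
    (hf : ContinuousOn f (Icc 0 A)) : Integrable f F := by
  have := hF.1
  have h : F.restrict (Icc 0 A) = F := Measure.restrict_eq_self_of_ae_mem hF.ae_mem
  rw [← h]
  exact hf.integrableOn_compact isCompact_Icc

theorem measurable_pout (hF : IsDistOn A F) : Measurable (pout F) := by
  have := hF.1
  exact (continuous_pcond.stronglyMeasurable.integral_prod_left (μ := F)).measurable

theorem pout_le (hF : IsDistOn A F) {y : ℝ} (hy : 0 ≤ y) :
    pout F y ≤ exp (-(1 / (1 + A ^ 2) * y)) := by
  have := hF.1
  have h := integral_mono_ae (hF.integrable_of_continuousOn (continuous_pcond_left y).continuousOn)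
    (integrable_const (exp (-(1 / (1 + A ^ 2) * y))))
    (hF.ae_mem.mono fun x hx => pcond_le hx hy)
  simpa [pout] using h

theorem le_pout (hF : IsDistOn A F) {y : ℝ} (hy : 0 ≤ y) :
    1 / (1 + A ^ 2) * exp (-y) ≤ pout F y := by
  have := hF.1
  have h := integral_mono_ae (integrable_const (1 / (1 + A ^ 2) * exp (-y)))
    (hF.integrable_of_continuousOn (continuous_pcond_left y).continuousOn)
    (hF.ae_mem.mono fun x hx => le_pcond hx hy)
  simpa [pout] using h

theorem pout_pos (hF : IsDistOn A F) {y : ℝ} (hy : 0 ≤ y) : 0 < pout F y :=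
  lt_of_lt_of_le (by positivity) (hF.le_pout hy)

theorem abs_log_pout_le (hF : IsDistOn A F) {y : ℝ} (hy : 0 < y) :
    |log (pout F y)| ≤ (1 + log (1 + A ^ 2)) * (1 + y) := by
  have hl : 0 ≤ log (1 + A ^ 2) := log_nonneg (by nlinarith [sq_nonneg A])
  have h1 : log (pout F y) ≤ 0 := by
    refine log_nonpos (hF.pout_pos hy.le).le ((hF.pout_le hy.le).trans ?_)
    rw [exp_le_one_iff, neg_nonpos]
    positivity
  have h2 := log_le_log (by positivity) (hF.le_pout hy.le)
  rw [log_mul (by positivity) (by positivity), log_exp, one_div, log_inv] at h2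
  rw [abs_of_nonpos h1]
  nlinarith

theorem linGrowth_log_pout (hF : IsDistOn A F) : LinGrowth (fun y => log (pout F y)) :=
  ⟨hF.measurable_pout.log, _, fun _ hy => hF.abs_log_pout_le hy⟩

theorem integrable_pcond_mul_prod (hF : IsDistOn A F) {g : ℝ → ℝ} (hg : LinGrowth g) :
    Integrable (Function.uncurry fun x y => pcond x y * g y)
      (F.prod (volume.restrict (Ioi 0))) := by
  have := hF.1
  obtain ⟨hm, c, hc⟩ := hg
  refine ((integrable_envelope A c).comp_snd F).mono'
    (continuous_pcond.measurable.mul (hm.comp measurable_snd)).aestronglyMeasurable ?_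
  have h1 : ∀ᵐ p ∂(F.prod (volume.restrict (Ioi (0 : ℝ)))), p.1 ∈ Icc 0 A :=
    Measure.quasiMeasurePreserving_fst.ae hF.ae_mem
  have h2 : ∀ᵐ p ∂(F.prod (volume.restrict (Ioi (0 : ℝ)))), p.2 ∈ Ioi (0 : ℝ) :=
    Measure.quasiMeasurePreserving_snd.ae (ae_restrict_mem measurableSet_Ioi)
  filter_upwards [h1, h2] with p hp1 hp2
  exact abs_pcond_mul_le hc hp1 hp2

theorem integral_chan (hF : IsDistOn A F) {g : ℝ → ℝ} (hg : LinGrowth g) :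
    ∫ x, chan g x ∂F = ∫ y in Ioi (0 : ℝ), pout F y * g y := by
  have := hF.1
  unfold chan
  rw [integral_integral_swap (hF.integrable_pcond_mul_prod hg)]
  simp only [integral_mul_const, pout]

theorem integrable_pout_mul (hF : IsDistOn A F) {g : ℝ → ℝ} (hg : LinGrowth g) :
    Integrable (fun y => pout F y * g y) (volume.restrict (Ioi 0)) := by
  have := hF.1
  have h := (hF.integrable_pcond_mul_prod hg).integral_prod_right
  simpa only [Function.uncurry, integral_mul_const, pout] using h

end IsDistOn

theorem linGrowth_const (c : ℝ) : LinGrowth (fun _ => c) :=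
  ⟨measurable_const, |c|, fun y hy => by nlinarith [abs_nonneg c]⟩

theorem linGrowth_id : LinGrowth (fun y => y) :=
  ⟨measurable_id, 1, fun y hy => by rw [abs_of_pos hy]; linarith⟩

theorem IsDistOn.integral_pout {A : ℝ} {F : Measure ℝ} (hF : IsDistOn A F) :
    ∫ y in Ioi (0 : ℝ), pout F y = 1 := by
  have := hF.1
  have h := hF.integral_chan (linGrowth_const 1)
  simpa [chan_one] using h.symm

/-- The negative conditional entropy `∫ p(y|x) log p(y|x) dy`, in unevaluated form. -/
noncomputable def negEntropy (x : ℝ) : ℝ :=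
  -log (1 + x ^ 2) * chan (fun _ => 1) x - 1 / (1 + x ^ 2) * chan (fun y => y) x

theorem continuousOn_negEntropy (A : ℝ) : ContinuousOn negEntropy (Icc 0 A) := by
  unfold negEntropy
  have h : ∀ x : ℝ, 1 + x ^ 2 ≠ 0 := fun x => by positivity
  refine ContinuousOn.sub (ContinuousOn.mul ?_ (continuousOn_chan (linGrowth_const 1)))
    (ContinuousOn.mul ?_ (continuousOn_chan linGrowth_id))
  · exact (Continuous.neg (Continuous.log (by fun_prop) h)).continuousOn
  · exact (Continuous.div (by fun_prop) (by fun_prop) h).continuousOn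

theorem idens_eq {A x : ℝ} {G : Measure ℝ} (hG : IsDistOn A G) (hx : x ∈ Icc 0 A) :
    idens G x = negEntropy x - chan (fun y => log (pout G y)) x := by
  unfold idens negEntropy chan
  rw [← integral_const_mul, ← integral_const_mul, ← integral_sub, ← integral_sub]
  · refine setIntegral_congr_fun measurableSet_Ioi fun y hy => ?_
    have hp : log (pcond x y) = -log (1 + x ^ 2) - 1 / (1 + x ^ 2) * y := by
      unfold pcond
      rw [log_mul (by positivity) (by positivity), log_exp, one_div, log_inv]
      ring
    simp only
    rw [log_div (pcond_pos x y).ne' (hG.pout_pos (le_of_lt hy)).ne', hp]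
    ring
  · exact ((integrable_pcond_mul (linGrowth_const 1) hx).const_mul _).sub
      ((integrable_pcond_mul linGrowth_id hx).const_mul _)
  · exact integrable_pcond_mul hG.linGrowth_log_pout hx
  · exact (integrable_pcond_mul (linGrowth_const 1) hx).const_mul _
  · exact (integrable_pcond_mul linGrowth_id hx).const_mul _

theorem IsDistOn.continuousOn_idens {A : ℝ} {G : Measure ℝ} (hG : IsDistOn A G) :
    ContinuousOn (idens G) (Icc 0 A) :=
  ((continuousOn_negEntropy A).sub (continuousOn_chan hG.linGrowth_log_pout)).congr
    fun _ hx => idens_eq hG hx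

theorem IsDistOn.integral_idens {A : ℝ} {F G : Measure ℝ} (hF : IsDistOn A F)
    (hG : IsDistOn A G) :
    ∫ x, idens G x ∂F =
      (∫ x, negEntropy x ∂F) - ∫ y in Ioi (0 : ℝ), pout F y * log (pout G y) := by
  rw [← hF.integral_chan hG.linGrowth_log_pout,
    ← integral_sub (hF.integrable_of_continuousOn (continuousOn_negEntropy A))
      (hF.integrable_of_continuousOn (continuousOn_chan hG.linGrowth_log_pout))]
  exact integral_congr_ae (hF.ae_mem.mono fun x hx => idens_eq hG hx)

theorem add_mul_sub_le_mul_log_div {p q u k : ℝ} (hp : 0 < p) (hq : 0 < q) (hu : |u| ≤ k)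
    (hk : k ≤ 1) : p * u - q * u + (p - q) - k ^ 2 * q ≤ p * log p - p * log q := by
  have h1 : exp u ≤ 1 + u + k ^ 2 := by
    have h := (abs_le.1 (abs_exp_sub_one_sub_id_le (hu.trans hk))).2
    have h2 : u ^ 2 ≤ k ^ 2 := sq_le_sq' (neg_le_of_abs_le hu) (le_of_abs_le hu)
    linarith
  have h2 := log_le_sub_one_of_pos (show 0 < q * exp u / p by positivity)
  rw [log_div (by positivity) hp.ne', log_mul hq.ne' (exp_pos u).ne', log_exp] at h2
  have h3 := mul_le_mul_of_nonneg_left h2 hp.le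
  have h4 : p * (q * exp u / p - 1) = q * exp u - p := by field_simp
  have h5 := mul_le_mul_of_nonneg_left h1 hq.le
  rw [h4] at h3
  linarith

/-- The divergence `∫ i(x; G) dF - I(F)` between the outputs of `F` and `G` bounds
differences of integrals of small test functions. -/
theorem IsDistOn.integral_chan_sub_le {A : ℝ} {F G : Measure ℝ} (hF : IsDistOn A F)
    (hG : IsDistOn A G) {u : ℝ → ℝ} {k : ℝ} (hu : Measurable u) (huk : ∀ y, 0 < y → |u y| ≤ k)
    (hk : k ≤ 1) :
    (∫ x, chan u x ∂F) - (∫ x, chan u x ∂G) - k ^ 2 ≤ (∫ x, idens G x ∂F) - MI F := by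
  have hk0 : 0 ≤ k := (abs_nonneg _).trans (huk 1 one_pos)
  have hl : LinGrowth u := ⟨hu, k, fun y hy => (huk y hy).trans (by nlinarith)⟩
  have hp := hF.integrable_pout_mul (linGrowth_const 1)
  have hq := hG.integrable_pout_mul (linGrowth_const 1)
  simp only [mul_one] at hp hq
  have h1 : Integrable (fun y => pout F y * u y - pout G y * u y) (volume.restrict (Ioi 0)) :=
    (hF.integrable_pout_mul hl).sub (hG.integrable_pout_mul hl)
  have h2 : Integrable (fun y => pout F y - pout G y) (volume.restrict (Ioi 0)) := hp.sub hq
  have h3 : Integrable (fun y => pout F y * u y - pout G y * u y + (pout F y - pout G y))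
      (volume.restrict (Ioi 0)) := h1.add h2
  have h := setIntegral_mono_on (h3.sub (hq.const_mul (k ^ 2)))
    ((hF.integrable_pout_mul hF.linGrowth_log_pout).sub
      (hF.integrable_pout_mul hG.linGrowth_log_pout)) measurableSet_Ioi
    (fun y (hy : 0 < y) => add_mul_sub_le_mul_log_div (hF.pout_pos hy.le) (hG.pout_pos hy.le)
      (huk y hy) hk)
  simp only [Pi.sub_apply] at h
  rw [integral_sub h3 (hq.const_mul (k ^ 2)), integral_add h1 h2,
    integral_sub (hF.integrable_pout_mul hl) (hG.integrable_pout_mul hl),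
    integral_sub hp hq, integral_const_mul, hF.integral_pout, hG.integral_pout,
    integral_sub (hF.integrable_pout_mul hF.linGrowth_log_pout)
      (hF.integrable_pout_mul hG.linGrowth_log_pout)] at h
  rw [MI, hF.integral_idens hG, hF.integral_idens hF, hF.integral_chan hl, hG.integral_chan hl]
  linarith

theorem IsDistOn.MI_le_integral_idens {A : ℝ} {F G : Measure ℝ} (hF : IsDistOn A F)
    (hG : IsDistOn A G) : MI F ≤ ∫ x, idens G x ∂F := by
  have h := hF.integral_chan_sub_le hG (u := fun _ => 0) (k := 0) measurable_const
    (by simp) zero_le_one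
  simp [chan] at h
  linarith

/-- The range of the channel operator on bounded functions is uniformly dense in `C([0, A])`. -/
theorem exists_chan_approx {A : ℝ} (hA : 0 ≤ A) {f : ℝ → ℝ} (hf : ContinuousOn f (Icc 0 A))
    {ε : ℝ} (hε : 0 < ε) :
    ∃ (w : ℝ → ℝ) (W : ℝ), Measurable w ∧ 0 < W ∧ (∀ y, 0 < y → |w y| ≤ W) ∧
      ∀ x ∈ Icc 0 A, |f x - chan w x| ≤ ε := by
  set h : ℝ → ℝ := fun t => f (√(t / (1 - t) - 1)) * (1 + t / (1 - t)) with hh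
  have hlt : ∀ t ∈ Icc (1 / 2) ((1 + A ^ 2) / (2 + A ^ 2)), 0 < 1 - t := by
    intro t ht
    have : (1 + A ^ 2) / (2 + A ^ 2) < 1 := by
      rw [div_lt_one (by positivity)]; linarith
    linarith [ht.2]
  have hcont : ContinuousOn h (Icc (1 / 2) ((1 + A ^ 2) / (2 + A ^ 2))) := by
    have hq : ContinuousOn (fun t : ℝ => t / (1 - t))
        (Icc (1 / 2) ((1 + A ^ 2) / (2 + A ^ 2))) :=
      continuousOn_id.div (by fun_prop) fun t ht => (hlt t ht).ne'
    refine ContinuousOn.mul (hf.comp (hq.sub continuousOn_const).sqrt fun t ht => ?_)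
      (continuousOn_const.add hq)
    refine ⟨sqrt_nonneg _, ?_⟩
    rw [sqrt_le_left hA, sub_le_iff_le_add, div_le_iff₀ (hlt t ht)]
    have := ht.2
    rw [le_div_iff₀ (by positivity)] at this
    nlinarith
  obtain ⟨q, hq⟩ := exists_polynomial_near_of_continuousOn _ _ h hcont ε hε
  have hbd : ∀ i : ℕ, ∀ y : ℝ, 0 < y → |y ^ i * exp (-(1 * y))| ≤ i.factorial := by
    intro i y hy
    have h1 := pow_div_factorial_le_exp y hy.le i
    rw [div_le_iff₀ (by positivity)] at h1
    rw [abs_of_nonneg (by positivity), one_mul, exp_neg, ← div_eq_mul_inv,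
      div_le_iff₀ (exp_pos y)]
    linarith
  refine ⟨fun y => ∑ i ∈ Finset.range (q.natDegree + 1),
      q.coeff i / i.factorial * (y ^ i * exp (-(1 * y))),
    ∑ i ∈ Finset.range (q.natDegree + 1), |q.coeff i| + 1, ?_, ?_, ?_, ?_⟩
  · fun_prop
  · positivity
  · intro y hy
    refine (Finset.abs_sum_le_sum_abs _ _).trans
      (le_trans (Finset.sum_le_sum fun i _ => ?_) (le_add_of_nonneg_right zero_le_one))
    rw [abs_mul, abs_div, Nat.abs_cast, div_mul_eq_mul_div, div_le_iff₀ (by positivity)]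
    exact mul_le_mul_of_nonneg_left (hbd i y hy) (abs_nonneg _)
  · intro x hx
    have hchan : chan (fun y => ∑ i ∈ Finset.range (q.natDegree + 1),
        q.coeff i / i.factorial * (y ^ i * exp (-(1 * y)))) x =
        q.eval ((1 + x ^ 2) / (2 + x ^ 2)) / (2 + x ^ 2) := by
      have h1 : ∀ i, chan (fun y => q.coeff i / i.factorial * (y ^ i * exp (-(1 * y)))) x =
          q.coeff i * ((1 + x ^ 2) / (2 + x ^ 2)) ^ i / (2 + x ^ 2) := by
        intro i
        have h2 := chan_pow_mul_exp x zero_le_one i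
        have h3 : 1 / (1 + x ^ 2) + 1 = (2 + x ^ 2) / (1 + x ^ 2) := by field_simp; ring
        unfold chan at h2 ⊢
        simp only [mul_left_comm (pcond x _) (q.coeff i / _)]
        rw [integral_const_mul, h2, h3, div_pow, div_pow]
        field_simp
        ring
      rw [Polynomial.eval_eq_sum_range, Finset.sum_div]
      simp only [← h1]
      unfold chan
      simp only [Finset.mul_sum]
      refine integral_finsetSum _ fun i _ => integrable_pcond_mul (A := A) (x := x) ⟨by fun_prop,
        |q.coeff i|, fun y hy => ?_⟩ hx
      rw [abs_mul, abs_div, Nat.abs_cast, div_mul_eq_mul_div, div_le_iff₀ (by positivity), mul_assoc]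
      refine mul_le_mul_of_nonneg_left ((hbd i y hy).trans ?_) (abs_nonneg _)
      exact le_mul_of_one_le_left (by positivity) (by linarith)
    have ht : (1 + x ^ 2) / (2 + x ^ 2) ∈ Icc (1 / 2) ((1 + A ^ 2) / (2 + A ^ 2)) := by
      have h1 : x ^ 2 ≤ A ^ 2 := pow_le_pow_left₀ hx.1 hx.2 2
      constructor
      · rw [div_le_div_iff₀ (by positivity) (by positivity)]; nlinarith [sq_nonneg x]
      · rw [div_le_div_iff₀ (by positivity) (by positivity)]; nlinarith
    have h1 := hq _ ht
    have h2 : (1 + x ^ 2) / (2 + x ^ 2) / (1 - (1 + x ^ 2) / (2 + x ^ 2)) = 1 + x ^ 2 := by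
      have : 1 - (1 + x ^ 2) / (2 + x ^ 2) = 1 / (2 + x ^ 2) := by field_simp; ring
      rw [this]; field_simp
    simp only [hh, h2, add_sub_cancel_left, sqrt_sq hx.1] at h1
    rw [hchan, abs_sub_comm]
    have h3 : q.eval ((1 + x ^ 2) / (2 + x ^ 2)) / (2 + x ^ 2) - f x =
        (q.eval ((1 + x ^ 2) / (2 + x ^ 2)) - f x * (1 + (1 + x ^ 2))) / (2 + x ^ 2) := by
      field_simp; ring
    rw [h3, abs_div, abs_of_pos (show (0 : ℝ) < 2 + x ^ 2 by positivity),
      div_le_iff₀ (by positivity)]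
    nlinarith [sq_nonneg x]

/-- The mixture `(1 - θ) F + θ G`. -/
noncomputable def mix (θ : ℝ) (F G : Measure ℝ) : Measure ℝ :=
  ENNReal.ofReal (1 - θ) • F + ENNReal.ofReal θ • G

section Mix

variable {A θ : ℝ} {F G : Measure ℝ}

theorem IsDistOn.mix (hF : IsDistOn A F) (hG : IsDistOn A G) (h0 : 0 ≤ θ) (h1 : θ ≤ 1) :
    IsDistOn A (mix θ F G) := by
  have := hF.1
  have := hG.1
  refine ⟨⟨?_⟩, ?_⟩
  · simp [_root_.mix, ← ENNReal.ofReal_add (sub_nonneg.2 h1) h0]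
  · simp [_root_.mix, hF.2, hG.2]

theorem integral_mix {f : ℝ → ℝ} (hF : Integrable f F) (hG : Integrable f G)
    (h0 : 0 ≤ θ) (h1 : θ ≤ 1) :
    ∫ x, f x ∂(mix θ F G) = (1 - θ) * ∫ x, f x ∂F + θ * ∫ x, f x ∂G := by
  rw [mix, integral_add_measure (hF.smul_measure ENNReal.ofReal_ne_top)
    (hG.smul_measure ENNReal.ofReal_ne_top), integral_smul_measure, integral_smul_measure,
    ENNReal.toReal_ofReal (sub_nonneg.2 h1), ENNReal.toReal_ofReal h0, smul_eq_mul, smul_eq_mul]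

theorem IsDistOn.integral_mix (hF : IsDistOn A F) (hG : IsDistOn A G) {f : ℝ → ℝ}
    (hf : ContinuousOn f (Icc 0 A)) (h0 : 0 ≤ θ) (h1 : θ ≤ 1) :
    ∫ x, f x ∂(_root_.mix θ F G) = (1 - θ) * ∫ x, f x ∂F + θ * ∫ x, f x ∂G :=
  _root_.integral_mix (hF.integrable_of_continuousOn hf) (hG.integrable_of_continuousOn hf) h0 h1

theorem IsDistOn.tendsto_integral_idens_mix (hF : IsDistOn A F) (hG : IsDistOn A G)
    {t : ℕ → ℝ} (h0 : ∀ n, 0 ≤ t n) (h1 : ∀ n, t n ≤ 1) (ht : Tendsto t atTop (nhds 0)) :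
    Tendsto (fun n => ∫ x, idens (_root_.mix (t n) G F) x ∂F) atTop
      (nhds (∫ x, idens G x ∂F)) := by
  have hm : ∀ n, IsDistOn A (_root_.mix (t n) G F) := fun n => hG.mix hF (h0 n) (h1 n)
  rw [hF.integral_idens hG]
  simp only [fun n => hF.integral_idens (hm n)]
  refine tendsto_const_nhds.sub (tendsto_integral_of_dominated_convergence
    (envelope A (1 + log (1 + A ^ 2)))
    (fun n => (hF.measurable_pout.mul (hm n).measurable_pout.log).aestronglyMeasurable)
    (integrable_envelope A _) (fun n => ?_) ?_)
  · filter_upwards [ae_restrict_mem measurableSet_Ioi] with y hy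
    rw [norm_mul, norm_of_nonneg (hF.pout_pos (le_of_lt hy)).le]
    exact mul_le_mul (hF.pout_le (le_of_lt hy)) ((hm n).abs_log_pout_le hy) (norm_nonneg _)
      (exp_pos _).le
  · filter_upwards [ae_restrict_mem measurableSet_Ioi] with y hy
    refine tendsto_const_nhds.mul (Tendsto.log ?_ (hG.pout_pos (le_of_lt hy)).ne')
    have he : ∀ n, pout (_root_.mix (t n) G F) y = (1 - t n) * pout G y + t n * pout F y :=
      fun n => hG.integral_mix hF (continuous_pcond_left y).continuousOn (h0 n) (h1 n)
    simp only [he]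
    have := ((tendsto_const_nhds (x := (1 : ℝ)).sub ht).mul_const (pout G y)).add
      (ht.mul_const (pout F y))
    simpa using this

end Mix

theorem continuous_besselI0 : Continuous besselI0 := by
  have key : ∀ n : ℕ, ContinuousOn besselI0 (Metric.ball (0 : ℝ) n) := by
    intro n
    unfold besselI0
    refine continuousOn_tsum (fun i => Continuous.continuousOn (by fun_prop))
      (summable_pow_div_factorial ((n : ℝ) ^ 2 / 4)) fun i x hx => ?_
    have hx' : |x| ≤ n := by simpa using (Metric.mem_ball.1 hx).le
    have h1 : x ^ 2 ≤ (n : ℝ) ^ 2 := sq_le_sq' (neg_le_of_abs_le hx') (le_of_abs_le hx')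
    have h2 : (1 : ℝ) ≤ i.factorial := by exact_mod_cast Nat.one_le_iff_ne_zero.2 i.factorial_ne_zero
    rw [norm_of_nonneg (by positivity)]
    have h3 : (i.factorial : ℝ) ≤ (i.factorial : ℝ) ^ 2 := by nlinarith
    gcongr
  rw [continuous_iff_continuousAt]
  intro x
  obtain ⟨n, hn⟩ := exists_nat_gt |x|
  exact (key n).continuousAt (Metric.isOpen_ball.mem_nhds (by simpa using hn))

theorem continuous_EH (B h2 : ℝ) : Continuous (EH B h2) :=
  continuous_besselI0.comp (by fun_prop)

theorem nonpos_of_forall_mul_add_lt {a b u : ℝ} (h : ∀ k > 0, k * a + b < u) : a ≤ 0 := by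
  by_contra! ha
  have h1 := h ((|u - b| + 1) / a) (by positivity)
  rw [div_mul_cancel₀ _ ha.ne'] at h1
  linarith [le_abs_self (u - b)]

theorem nonneg_of_forall_mul_lt {a u : ℝ} (h : ∀ k > 0, k * a < u) : 0 ≤ u := by
  have h1 : Tendsto (fun k : ℝ => k * a) (nhdsWithin 0 (Ioi 0)) (nhds (0 * a)) :=
    ((continuous_id.mul continuous_const).tendsto 0).mono_left nhdsWithin_le_nhds
  rw [zero_mul] at h1
  exact le_of_tendsto h1 (eventually_mem_nhdsWithin.mono fun k hk => (h k hk).le)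

/-- Lagrange multipliers for a convex set of (objective, slack, slack) triples under
Slater's condition. -/
theorem exists_multipliers {V : Set (ℝ × ℝ × ℝ)} (hV : Convex ℝ V)
    (hd : ∀ v ∈ V, 0 < v.2.1 → 0 < v.2.2 → v.1 ≤ 0)
    (hs : ∃ v ∈ V, 0 < v.2.1 ∧ 0 < v.2.2) :
    ∃ l1 l2 : ℝ, 0 ≤ l1 ∧ 0 ≤ l2 ∧ ∀ v ∈ V, v.1 + l1 * v.2.1 + l2 * v.2.2 ≤ 0 := by
  obtain ⟨f, u, hS, hfV⟩ := geometric_hahn_banach_open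
    (s := Ioi (0 : ℝ) ×ˢ Ioi (0 : ℝ) ×ˢ Ioi (0 : ℝ))
    ((convex_Ioi 0).prod ((convex_Ioi 0).prod (convex_Ioi 0)))
    (isOpen_Ioi.prod (isOpen_Ioi.prod isOpen_Ioi)) hV
    (Set.disjoint_left.2 fun v hv hvV => (hd v hvV hv.2.1 hv.2.2).not_gt hv.1)
  set α := f (1, 0, 0) with hα
  set β := f (0, 1, 0) with hβ
  set γ := f (0, 0, 1) with hγ
  have hf : ∀ a b c : ℝ, f (a, b, c) = a * α + b * β + c * γ := by
    intro a b c
    rw [hα, hβ, hγ, ← smul_eq_mul, ← smul_eq_mul, ← smul_eq_mul, ← map_smul, ← map_smul,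
      ← map_smul, ← map_add, ← map_add]
    simp
  have hS' : ∀ a b c : ℝ, 0 < a → 0 < b → 0 < c → a * α + b * β + c * γ < u :=
    fun a b c ha hb hc => hf a b c ▸ hS (a, b, c) ⟨ha, hb, hc⟩
  have hα0 : α ≤ 0 := nonpos_of_forall_mul_add_lt (b := β + γ) (u := u) fun k hk => by
    linarith [hS' k 1 1 hk one_pos one_pos]
  have hβ0 : β ≤ 0 := nonpos_of_forall_mul_add_lt (b := α + γ) (u := u) fun k hk => by
    linarith [hS' 1 k 1 one_pos hk one_pos]
  have hγ0 : γ ≤ 0 := nonpos_of_forall_mul_add_lt (b := α + β) (u := u) fun k hk => by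
    linarith [hS' 1 1 k one_pos one_pos hk]
  have hu : 0 ≤ u := nonneg_of_forall_mul_lt (a := α + β + γ) fun k hk => by
    linarith [hS' k k k hk hk hk]
  have hV' : ∀ v ∈ V, 0 ≤ v.1 * α + v.2.1 * β + v.2.2 * γ :=
    fun v hv => hu.trans (hf v.1 v.2.1 v.2.2 ▸ hfV v hv)
  have hαneg : α < 0 := by
    refine lt_of_le_of_ne hα0 fun h => ?_
    obtain ⟨v, hv, h1, h2⟩ := hs
    have h3 := hV' v hv
    have h4 := hfV v hv
    rw [show f v = _ from hf v.1 v.2.1 v.2.2] at h4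
    have h5 := mul_nonpos_of_nonneg_of_nonpos h1.le hβ0
    have h6 := mul_nonpos_of_nonneg_of_nonpos h2.le hγ0
    have h7 := hS' 1 v.2.1 v.2.2 one_pos h1 h2
    rw [h] at h3 h4 h7
    linarith
  refine ⟨β / α, γ / α, div_nonneg_of_nonpos hβ0 hα0, div_nonneg_of_nonpos hγ0 hα0,
    fun v hv => ?_⟩
  have hne := hαneg.ne
  have h1 : v.1 + β / α * v.2.1 + γ / α * v.2.2 = (v.1 * α + v.2.1 * β + v.2.2 * γ) / α := by
    field_simp
  rw [h1]
  exact div_nonpos_of_nonneg_of_nonpos (hV' v hv) hα0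

section Capacity

variable {A P B h2 Ereq : ℝ} {F G : Measure ℝ}

theorem Feas.mix {θ : ℝ} (hF : Feas A P B h2 Ereq F) (hG : Feas A P B h2 Ereq G)
    (h0 : 0 ≤ θ) (h1 : θ ≤ 1) : Feas A P B h2 Ereq (mix θ F G) := by
  refine ⟨hF.1.mix hG.1 h0 h1, ?_, ?_⟩
  · rw [hF.1.integral_mix hG.1 (by fun_prop) h0 h1]
    nlinarith [mul_le_mul_of_nonneg_left hF.2.1 (sub_nonneg.2 h1),
      mul_le_mul_of_nonneg_left hG.2.1 h0]
  · rw [hF.1.integral_mix hG.1 (continuous_EH B h2).continuousOn h0 h1]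
    nlinarith [mul_le_mul_of_nonneg_left hF.2.2 (sub_nonneg.2 h1),
      mul_le_mul_of_nonneg_left hG.2.2 h0]

theorem Feas.MI_le_Cap (hfin : BddAbove (MI '' {F | Feas A P B h2 Ereq F}))
    (hF : Feas A P B h2 Ereq F) : MI F ≤ Cap A P B h2 Ereq :=
  le_csSup hfin ⟨F, hF, rfl⟩

theorem Feas.integral_idens_le_of_forall_MI_le (hG : Feas A P B h2 Ereq G)
    (hmax : ∀ F, Feas A P B h2 Ereq F → MI F ≤ MI G) (hF : Feas A P B h2 Ereq F) :
    ∫ x, idens G x ∂F ≤ MI G := by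
  have h0 : ∀ n : ℕ, (0 : ℝ) < 1 / ((n : ℝ) + 1) := fun n => by positivity
  have h1 : ∀ n : ℕ, 1 / ((n : ℝ) + 1) ≤ 1 := fun n => by
    rw [div_le_one (by positivity)]; linarith [(Nat.cast_nonneg n : (0 : ℝ) ≤ n)]
  refine le_of_tendsto (hF.1.tendsto_integral_idens_mix hG.1 (fun n => (h0 n).le) h1
    tendsto_one_div_add_atTop_nhds_zero_nat) (Eventually.of_forall fun n => ?_)
  have hm := hG.mix hF (h0 n).le (h1 n)
  have h2 := hmax _ hm
  rw [MI, hG.1.integral_mix hF.1 hm.1.continuousOn_idens (h0 n).le (h1 n)] at h2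
  have h3 := mul_le_mul_of_nonneg_left (hG.1.MI_le_integral_idens hm.1) (sub_nonneg.2 (h1 n))
  refine le_of_mul_le_mul_left ?_ (h0 n)
  linarith

theorem isDistOn_dirac {x : ℝ} (hx : x ∈ Icc 0 A) : IsDistOn A (Measure.dirac x) := by
  refine ⟨inferInstance, ?_⟩
  rw [Measure.dirac_apply' _ measurableSet_Icc.compl]
  simpa using hx

/-- A feasible distribution whose information density integrates to at most `C` against every
feasible distribution achieves capacity. -/
theorem Feas.Cap_le_MI (hA : 0 ≤ A) (hG : Feas A P B h2 Ereq G)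
    (h : ∀ F, Feas A P B h2 Ereq F → ∫ x, idens G x ∂F ≤ Cap A P B h2 Ereq) :
    Cap A P B h2 Ereq ≤ MI G := by
  refine le_of_forall_pos_le_add fun ε hε => ?_
  obtain ⟨w, W, hwm, hW, hwW, hw⟩ := exists_chan_approx hA hG.1.continuousOn_idens
    (show 0 < ε / 5 by positivity)
  obtain ⟨t, ht0, ht, ht1, ht2⟩ : ∃ t > 0, t ≤ 1 ∧ t * W ≤ 1 ∧ t * W ^ 2 ≤ ε / 5 := by
    refine ⟨min 1 (min (1 / W) (ε / 5 / W ^ 2)), by positivity, min_le_left _ _, ?_, ?_⟩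
    · rw [← le_div_iff₀ hW]; exact (min_le_right _ _).trans (min_le_left _ _)
    · rw [← le_div_iff₀ (by positivity)]; exact (min_le_right _ _).trans (min_le_right _ _)
  have hδ : 0 < t * (ε / 5) := by positivity
  obtain ⟨_, ⟨F, hF, rfl⟩, hFC⟩ := exists_lt_of_lt_csSup (s := MI '' {F | Feas A P B h2 Ereq F})
    ⟨_, G, hG, rfl⟩ (sub_lt_self (Cap A P B h2 Ereq) hδ)
  have hFC' : Cap A P B h2 Ereq - t * (ε / 5) < MI F := hFC
  have hbd : ∀ y, 0 < y → |t * w y| ≤ t * W := fun y hy => by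
    rw [abs_mul, abs_of_pos ht0]; exact mul_le_mul_of_nonneg_left (hwW y hy) ht0.le
  have hdiv := hF.1.integral_chan_sub_le hG.1 (hwm.const_mul t) hbd ht1
  have hchan : chan (fun y => t * w y) = fun x => t * chan w x := by
    ext x
    simp only [chan, mul_left_comm _ t, integral_const_mul]
  simp only [hchan, integral_const_mul] at hdiv
  have hcont : ContinuousOn (chan w) (Icc 0 A) :=
    continuousOn_chan ⟨hwm, W, fun y hy => (hwW y hy).trans (by nlinarith)⟩
  have key : (∫ x, chan w x ∂F) - ∫ x, chan w x ∂G ≤ 2 * (ε / 5) := by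
    have h3 := h F hF
    refine le_of_mul_le_mul_left ?_ ht0
    have h4 := mul_le_mul_of_nonneg_left ht2 ht0.le
    nlinarith
  have happrox : ∀ H, IsDistOn A H →
      |(∫ x, idens G x ∂H) - ∫ x, chan w x ∂H| ≤ ε / 5 := by
    intro H hH
    have := hH.1
    rw [← integral_sub (hH.integrable_of_continuousOn hG.1.continuousOn_idens)
      (hH.integrable_of_continuousOn hcont)]
    have h3 := norm_integral_le_of_norm_le_const (μ := H) (f := fun x => idens G x - chan w x)
      (hH.ae_mem.mono hw)
    simpa using h3
  have h3 := (abs_le.1 (happrox F hF.1)).2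
  have h4 := (abs_le.1 (happrox G hG.1)).1
  have h5 := hF.1.MI_le_integral_idens hG.1
  have h6 : t * (ε / 5) ≤ ε / 5 := mul_le_of_le_one_left (by positivity) ht
  have h7 : MI G = ∫ x, idens G x ∂G := rfl
  linarith

theorem Feas.exists_multipliers (hG : Feas A P B h2 Ereq G)
    (hslater : ∃ x₁ ∈ Icc (0 : ℝ) A, x₁ ^ 2 < P ∧ Ereq < EH B h2 x₁)
    (hmax : ∀ F, Feas A P B h2 Ereq F → MI F ≤ MI G) :
    ∃ l1 l2 : ℝ, 0 ≤ l1 ∧ 0 ≤ l2 ∧ ∀ F, IsDistOn A F →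
      (∫ x, idens G x ∂F) - MI G + l1 * (P - ∫ x, x ^ 2 ∂F)
        + l2 * ((∫ x, EH B h2 x ∂F) - Ereq) ≤ 0 := by
  set φ : Measure ℝ → ℝ × ℝ × ℝ := fun F =>
    ((∫ x, idens G x ∂F) - MI G, P - ∫ x, x ^ 2 ∂F, (∫ x, EH B h2 x ∂F) - Ereq) with hφ
  suffices h : ∃ l1 l2 : ℝ, 0 ≤ l1 ∧ 0 ≤ l2 ∧
      ∀ v ∈ φ '' {F | IsDistOn A F}, v.1 + l1 * v.2.1 + l2 * v.2.2 ≤ 0 by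
    obtain ⟨l1, l2, hl1, hl2, h⟩ := h
    exact ⟨l1, l2, hl1, hl2, fun F hF => h _ ⟨F, hF, rfl⟩⟩
  refine _root_.exists_multipliers ?_ ?_ ?_
  · rintro _ ⟨F, hF, rfl⟩ _ ⟨H, hH, rfl⟩ a b ha hb hab
    obtain rfl : a = 1 - b := by linarith
    have hb1 : b ≤ 1 := by linarith
    refine ⟨_root_.mix b F H, hF.mix hH hb hb1, ?_⟩
    simp only [hφ, hF.integral_mix hH hG.1.continuousOn_idens hb hb1,
      hF.integral_mix hH (continuous_pow 2).continuousOn hb hb1,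
      hF.integral_mix hH (continuous_EH B h2).continuousOn hb hb1,
      Prod.smul_mk, Prod.mk_add_mk, smul_eq_mul, Prod.mk.injEq]
    refine ⟨?_, ?_, ?_⟩ <;> ring
  · rintro _ ⟨F, hF, rfl⟩ h1 h2
    exact sub_nonpos.2 (hG.integral_idens_le_of_forall_MI_le hmax
      ⟨hF, (sub_pos.1 h1).le, (sub_pos.1 h2).le⟩)
  · obtain ⟨x, hx, h1, h2⟩ := hslater
    exact ⟨_, ⟨_, isDistOn_dirac hx, rfl⟩, by simpa [hφ] using h1, by simpa [hφ] using h2⟩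

end Capacity

/-- Under Slater's condition (and finiteness of `C`), `F* ∈ Ω`
achieves `I(F*) = C` if and only if there exist `λ₁, λ₂ ≥ 0` with complementary
slackness and, for every Borel probability measure `F` on `[0,A]`,
`∫ i(x;F*) dF ≤ C + λ₁(∫x²dF − P) + λ₂(E_req − ∫ℰ dF)`. -/
theorem stmt2 (A P B h2 Ereq : ℝ) (hA : 0 < A) (hP : 0 < P) (hB : 0 < B) (hh2 : 0 < h2)
    (hslater : ∃ x₁ ∈ Set.Icc (0 : ℝ) A, x₁ ^ 2 < P ∧ Ereq < EH B h2 x₁)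
    (hfin : BddAbove (MI '' {F | Feas A P B h2 Ereq F}))
    (Fstar : Measure ℝ) (hFstar : Feas A P B h2 Ereq Fstar) :
    MI Fstar = Cap A P B h2 Ereq ↔
      ∃ l1 l2 : ℝ, 0 ≤ l1 ∧ 0 ≤ l2 ∧
        l1 * ((∫ x, x ^ 2 ∂Fstar) - P) = 0 ∧
        l2 * (Ereq - ∫ x, EH B h2 x ∂Fstar) = 0 ∧
        ∀ F : Measure ℝ, IsDistOn A F →
          (∫ x, idens Fstar x ∂F) ≤
            Cap A P B h2 Ereq + l1 * ((∫ x, x ^ 2 ∂F) - P)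
              + l2 * (Ereq - ∫ x, EH B h2 x ∂F) := by
  constructor
  · intro hC
    obtain ⟨l1, l2, hl1, hl2, h⟩ := hFstar.exists_multipliers hslater
      fun F hF => hC ▸ hF.MI_le_Cap hfin
    have h0 := h Fstar hFstar.1
    rw [show ∫ x, idens Fstar x ∂Fstar = MI Fstar from rfl, sub_self] at h0
    have h1 := mul_nonneg hl1 (sub_nonneg.2 hFstar.2.1)
    have h2 := mul_nonneg hl2 (sub_nonneg.2 hFstar.2.2)
    refine ⟨l1, l2, hl1, hl2, by linarith, by linarith, fun F hF => ?_⟩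
    rw [← hC]
    linarith [h F hF]
  · rintro ⟨l1, l2, hl1, hl2, -, -, h⟩
    refine le_antisymm (hFstar.MI_le_Cap hfin) (hFstar.Cap_le_MI hA.le fun F hF => ?_)
    have h1 := mul_nonneg hl1 (sub_nonneg.2 hF.2.1)
    have h2 := mul_nonneg hl2 (sub_nonneg.2 hF.2.2)
    linarith [h F hF.1]
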